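/- For every n ≥ 3 and every ℓ ≥ 3, the minimum size of a (1, ≤ ℓ)-watching system in the cycle C_n on n vertices equals n. -/

import Mathlib

/-- The label of a set `A` of vertices with respect to a set `W` of watchers:
the set of watchers whose watching zone meets `A`. -/
def wLabelSet {V : Type} [DecidableEq V] (W : Finset (V × Finset V)) (A : Finset V) :
    Finset (V × Finset V) :=
  W.filter (fun w => ∃ x ∈ A, x ∈ w.2)

/-- `W` is a `(1, ≤ ℓ)`-watching system for `G`: every watcher `(v, Z)` satisfies
`Z ⊆ N_G[v]`, and the labels of all nonempty sets of at most `ℓ` vertices are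
nonempty and pairwise distinct. -/
def IsWatchingSystemLe {V : Type} [DecidableEq V] (G : SimpleGraph V) (ℓ : ℕ)
    (W : Finset (V × Finset V)) : Prop :=
  (∀ w ∈ W, ∀ x ∈ w.2, x = w.1 ∨ G.Adj w.1 x) ∧
  (∀ A : Finset V, A.Nonempty → A.card ≤ ℓ → (wLabelSet W A).Nonempty) ∧
  (∀ A B : Finset V, A.Nonempty → B.Nonempty → A.card ≤ ℓ → B.card ≤ ℓ →
    wLabelSet W A = wLabelSet W B → A = B)

/-- The minimum size of a `(1, ≤ ℓ)`-watching system of `G`. -/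
noncomputable def watchingNumberLe {V : Type} [DecidableEq V] (G : SimpleGraph V)
    (ℓ : ℕ) : ℕ :=
  sInf {k | ∃ W : Finset (V × Finset V), IsWatchingSystemLe G ℓ W ∧ W.card = k}

/-- The path on `n` vertices `0, 1, …, n−1`, with edges between consecutive vertices. -/
def pathG (n : ℕ) : SimpleGraph (Fin n) :=
  SimpleGraph.fromRel (fun i j => (i : ℕ) + 1 = (j : ℕ))

/-- The cycle on `n` vertices `0, 1, …, n−1`, with edges between consecutive vertices
modulo `n`. -/
def cycleG (n : ℕ) : SimpleGraph (Fin n) :=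
  SimpleGraph.fromRel (fun i j => ((i : ℕ) + 1) % n = (j : ℕ))

lemma wl_single {n : ℕ} (A : Finset (Fin n)) (v : Fin n) :
    (v, ({v} : Finset (Fin n))) ∈ wLabelSet (Finset.univ.image (fun v : Fin n => (v, ({v} : Finset (Fin n))))) A
      ↔ v ∈ A := by
  simp [wLabelSet]

lemma single_system (n ℓ : ℕ) : IsWatchingSystemLe (cycleG n) ℓ
    (Finset.univ.image (fun v : Fin n => (v, ({v} : Finset (Fin n))))) := by
  refine ⟨?_, ?_, ?_⟩
  · intro w hw x hx
    simp only [Finset.mem_image, Finset.mem_univ, true_and] at hw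
    obtain ⟨v, rfl⟩ := hw
    left
    simpa using hx
  · rintro A ⟨v, hv⟩ _
    exact ⟨_, (wl_single A v).2 hv⟩
  · intro A B _ _ _ _ h
    ext v
    rw [← wl_single A v, h, wl_single]

lemma zone_card {n : ℕ} (hn : 3 ≤ n) (v : Fin n) (Z : Finset (Fin n))
    (h : ∀ x ∈ Z, x = v ∨ (cycleG n).Adj v x) : Z.card ≤ 3 := by
  have hs : Z ⊆ {v, ⟨((v : ℕ) + 1) % n, Nat.mod_lt _ (by omega)⟩,
      ⟨((v : ℕ) + (n - 1)) % n, Nat.mod_lt _ (by omega)⟩} := by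
    intro x hx
    simp only [Finset.mem_insert, Finset.mem_singleton]
    rcases h x hx with h | h
    · exact Or.inl h
    · right
      simp only [cycleG, SimpleGraph.fromRel_adj] at h
      rcases h.2 with h | h
      · left
        exact Fin.ext h.symm
      · right
        apply Fin.ext
        simp only
        have hx := x.2
        by_cases hc : (x : ℕ) + 1 < n
        · rw [Nat.mod_eq_of_lt hc] at h
          rw [← h, show (x : ℕ) + 1 + (n - 1) = x + n by omega, Nat.add_mod_right, Nat.mod_eq_of_lt hx]
        · have : (x : ℕ) + 1 = n := by omega
          rw [this, Nat.mod_self] at h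
          rw [← h, Nat.mod_eq_of_lt (by omega)]
          omega
  exact (Finset.card_le_card hs).trans Finset.card_le_three

lemma deg_bound {n ℓ : ℕ} (hℓ : 3 ≤ ℓ) {W : Finset (Fin n × Finset (Fin n))}
    (hW : IsWatchingSystemLe (cycleG n) ℓ W) (x : Fin n)
    (hx : ∀ w ∈ W, x ∈ w.2 → w.2.card ≠ 1) : 3 ≤ (W.filter (fun w => x ∈ w.2)).card := by
  by_contra! hlt
  have hy : ∀ w : Fin n × Finset (Fin n), ∃ y, w ∈ W → x ∈ w.2 → y ∈ w.2 ∧ y ≠ x := by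
    intro w
    by_cases h : w ∈ W ∧ x ∈ w.2
    · have h0 : 0 < w.2.card := Finset.card_pos.2 ⟨x, h.2⟩
      have h1 := hx w h.1 h.2
      obtain ⟨y, hy, hne⟩ := Finset.exists_mem_ne (s := w.2) (by omega) x
      exact ⟨y, fun _ _ => ⟨hy, hne⟩⟩
    · exact ⟨x, fun a b => absurd ⟨a, b⟩ h⟩
  choose f hf using hy
  let A := (W.filter (fun w => x ∈ w.2)).image f
  have hAc : A.card ≤ 2 := Finset.card_image_le.trans (by omega)
  have hxA : x ∉ A := by
    intro h
    obtain ⟨w, hw, e⟩ := Finset.mem_image.1 h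
    rw [Finset.mem_filter] at hw
    exact (hf w hw.1 hw.2).2 e
  have hAne : A.Nonempty := by
    obtain ⟨w, hw⟩ := hW.2.1 {x} (by simp) (by simp; omega)
    simp only [wLabelSet, Finset.mem_filter, Finset.mem_singleton, exists_eq_left] at hw
    exact ⟨f w, Finset.mem_image_of_mem f (Finset.mem_filter.2 hw)⟩
  have key : wLabelSet W (insert x A) = wLabelSet W A := by
    ext w
    simp only [wLabelSet, Finset.mem_filter, Finset.mem_insert]
    constructor
    · rintro ⟨hw, y, rfl | hy, hyw⟩
      · exact ⟨hw, f w, Finset.mem_image_of_mem f (Finset.mem_filter.2 ⟨hw, hyw⟩), (hf w hw hyw).1⟩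
      · exact ⟨hw, y, hy, hyw⟩
    · rintro ⟨hw, y, hy, hyw⟩
      exact ⟨hw, y, Or.inr hy, hyw⟩
  have := hW.2.2 (insert x A) A (by simp) hAne
    ((Finset.card_insert_le _ _).trans (by omega)) (by omega) key
  exact hxA (this ▸ Finset.mem_insert_self x A)

lemma system_lower {n ℓ : ℕ} (hn : 3 ≤ n) (hℓ : 3 ≤ ℓ) {W : Finset (Fin n × Finset (Fin n))}
    (hW : IsWatchingSystemLe (cycleG n) ℓ W) : n ≤ W.card := by
  have h1 : ∀ x : Fin n, (1 : ℚ) ≤ ∑ w ∈ W.filter (fun w => x ∈ w.2), (1 : ℚ) / w.2.card := by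
    intro x
    by_cases h : ∀ w ∈ W, x ∈ w.2 → w.2.card ≠ 1
    · have h3 := deg_bound hℓ hW x h
      have h3' : (3 : ℚ) ≤ (W.filter (fun w => x ∈ w.2)).card := by exact_mod_cast h3
      have : ∑ w ∈ W.filter (fun w => x ∈ w.2), (1 / 3 : ℚ) ≤
          ∑ w ∈ W.filter (fun w => x ∈ w.2), (1 : ℚ) / w.2.card := by
        apply Finset.sum_le_sum
        intro w hw
        rw [Finset.mem_filter] at hw
        have a : (w.2.card : ℚ) ≤ 3 := by
          exact_mod_cast zone_card hn w.1 w.2 (hW.1 w hw.1)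
        have b : (0 : ℚ) < w.2.card := by
          exact_mod_cast Finset.card_pos.2 ⟨x, hw.2⟩
        exact one_div_le_one_div_of_le b a
      rw [Finset.sum_const, nsmul_eq_mul] at this
      linarith
    · push Not at h
      obtain ⟨w, hw, hxw, hc⟩ := h
      have := Finset.single_le_sum (f := fun w : Fin n × Finset (Fin n) => (1 : ℚ) / w.2.card)
        (s := W.filter (fun w => x ∈ w.2)) (fun i _ => by positivity)
        (Finset.mem_filter.2 ⟨hw, hxw⟩)
      simpa [hc] using this
  have h2 : (n : ℚ) ≤ W.card := by
    calc (n : ℚ) = ∑ _x : Fin n, (1 : ℚ) := by simp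
      _ ≤ ∑ x : Fin n, ∑ w ∈ W.filter (fun w => x ∈ w.2), (1 : ℚ) / w.2.card :=
        Finset.sum_le_sum (fun x _ => h1 x)
      _ = ∑ w ∈ W, ∑ x : Fin n, if x ∈ w.2 then (1 : ℚ) / w.2.card else 0 := by
        rw [Finset.sum_comm]
        simp only [Finset.sum_filter]
      _ ≤ ∑ w ∈ W, (1 : ℚ) := by
        apply Finset.sum_le_sum
        intro w _
        rw [Finset.sum_ite_mem, Finset.univ_inter, Finset.sum_const, nsmul_eq_mul, mul_one_div]
        exact div_self_le_one _
      _ = W.card := by simp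
  exact_mod_cast h2

/-- For every `n ≥ 3` and every `ℓ ≥ 3`, the minimum size of a `(1, ≤ ℓ)`-watching
system in `C_n` equals `n`. -/
theorem watchingNumberLe_ge_three_cycle (n ℓ : ℕ) (hn : 3 ≤ n) (hℓ : 3 ≤ ℓ) :
    watchingNumberLe (cycleG n) ℓ = n := by
  have hmem : n ∈ {k | ∃ W : Finset (Fin n × Finset (Fin n)),
      IsWatchingSystemLe (cycleG n) ℓ W ∧ W.card = k} := by
    refine ⟨_, single_system n ℓ, ?_⟩
    rw [Finset.card_image_of_injective _ (fun a b h => (Prod.ext_iff.1 h).1)]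
    simp
  apply le_antisymm
  · exact Nat.sInf_le hmem
  · apply le_csInf ⟨n, hmem⟩
    rintro k ⟨W, hW, rfl⟩
    exact system_lower hn hℓ hW
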